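/- Let P and Q each carry two preorders ≤ and ≤* with ≤* contained in ≤ and with a common greatest element, and let π : P → Q be a projection of Prikry type. If (P, ≤, ≤*) has the Prikry property, then (Q, ≤, ≤*) also has the Prikry property. Here the Prikry property for (P, ≤, ≤*) is the statement: for every pair D₀, D₁ of ≤-downward-closed subsets of P such that D₀ ∪ D₁ is dense in (P, ≤) and every element of D₀ is ≤-incompatible with every element of D₁ (no element of D₀ and element of D₁ have a common ≤-lower bound), and for every p ∈ P, there exists q ≤* p with q ∈ D₀ ∪ D₁. -/

import Mathlib

/-- `D` is downward closed with respect to the relation `le`. -/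
def IsDownwardClosed {α : Type*} (le : α → α → Prop) (D : Set α) : Prop :=
  ∀ p q : α, le p q → q ∈ D → p ∈ D

/-- The Prikry property for a pair of orders `(le, les)` on `α`: for all
downward-closed sets `D₀, D₁` whose union is `le`-dense and whose elements are
pairwise cross-incompatible, every `p` has a direct extension (`les`) in `D₀ ∪ D₁`. -/
def HasPrikryProperty {α : Type*} (le les : α → α → Prop) : Prop :=
  ∀ D₀ D₁ : Set α,
    IsDownwardClosed le D₀ →
    IsDownwardClosed le D₁ →
    (∀ p : α, ∃ d ∈ D₀ ∪ D₁, le d p) →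
    (∀ p ∈ D₀, ∀ q ∈ D₁, ¬ ∃ r : α, le r p ∧ le r q) →
    ∀ p : α, ∃ q : α, les q p ∧ q ∈ D₀ ∪ D₁

/-- If `π : P → Q` is a projection of Prikry type and `(P, ≤, ≤*)` has the
Prikry property, then so does `(Q, ≤, ≤*)`. (Lemma 2.6.) -/
theorem prikry_projection_transfers_prikry_property
    {P Q : Type*} [Preorder P] [Preorder Q] [OrderTop P] [OrderTop Q]
    (lesP : P → P → Prop) (lesQ : Q → Q → Prop)
    (hPrefl : ∀ p : P, lesP p p)
    (hPtrans : ∀ p q r : P, lesP p q → lesP q r → lesP p r)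
    (hQrefl : ∀ q : Q, lesQ q q)
    (hQtrans : ∀ p q r : Q, lesQ p q → lesQ q r → lesQ p r)
    (hPsub : ∀ p p' : P, lesP p p' → p ≤ p')
    (hQsub : ∀ q q' : Q, lesQ q q' → q ≤ q')
    (hPtop : ∀ p : P, lesP p ⊤)
    (hQtop : ∀ q : Q, lesQ q ⊤)
    (π : P → Q)
    (hTop : π ⊤ = ⊤)
    (hMono : ∀ p p' : P, p ≤ p' → π p ≤ π p')
    (hProj : ∀ (p : P) (q : Q), q ≤ π p → ∃ p' : P, p' ≤ p ∧ π p' ≤ q)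
    (hStarMono : ∀ p p' : P, lesP p p' → lesQ (π p) (π p'))
    (hStarProj : ∀ (p : P) (q : Q), q ≤ π p → ∃ p' : P, p' ≤ p ∧ lesQ (π p') q)
    (hP : HasPrikryProperty (· ≤ · : P → P → Prop) lesP) :
    HasPrikryProperty (· ≤ · : Q → Q → Prop) lesQ := by
  intro D₀ D₁ h₀ h₁ hDense hIncomp q
  obtain ⟨p, -, hpq⟩ := hStarProj ⊤ q (hTop ▸ le_top)
  obtain ⟨r, hrp, hr⟩ := hP (π ⁻¹' D₀) (π ⁻¹' D₁)
    (fun a b hab hb => h₀ _ _ (hMono a b hab) hb)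
    (fun a b hab hb => h₁ _ _ (hMono a b hab) hb)
    (fun a => by
      obtain ⟨d, hd, hda⟩ := hDense (π a)
      obtain ⟨a', ha', hd'⟩ := hProj a d hda
      exact ⟨a', hd.imp (h₀ _ _ hd') (h₁ _ _ hd'), ha'⟩)
    (fun a ha b hb ⟨c, hca, hcb⟩ =>
      hIncomp _ ha _ hb ⟨π c, hMono c a hca, hMono c b hcb⟩)
    p
  exact ⟨π r, hQtrans _ _ _ (hStarMono r p hrp) hpq, hr⟩
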